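/- Let G be a tree of cycles (all cycles of G are pairwise vertex-disjoint, and collapsing each cycle to a single vertex yields a tree) with girth g. Then for all positive integers a, b with a/b ≥ 2 + 1/⌊g/2⌋, G is free (a,b)-choosable. -/

import Mathlib

/-- An (L,b)-coloring of `G`: each vertex gets a `b`-element subset of its list,
with disjoint sets on adjacent vertices. -/
def IsLbColoring {V : Type*} (G : SimpleGraph V) (L : V → Finset ℤ) (b : ℕ)
    (c : V → Finset ℤ) : Prop :=
  (∀ v, c v ⊆ L v) ∧ (∀ v, (c v).card = b) ∧ ∀ ⦃v w⦄, G.Adj v w → Disjoint (c v) (c w)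

/-- `G` is (a,b)-choosable. -/
def Choosable {V : Type*} (G : SimpleGraph V) (a b : ℕ) : Prop :=
  ∀ L : V → Finset ℤ, (∀ v, (L v).card = a) → ∃ c, IsLbColoring G L b c

/-- `G` is free (a,b)-choosable. -/
def FreeChoosable {V : Type*} (G : SimpleGraph V) (a b : ℕ) : Prop :=
  ∀ L : V → Finset ℤ, (∀ v, (L v).card = a) →
    ∀ v₀ : V, ∀ c₀ : Finset ℤ, c₀ ⊆ L v₀ → c₀.card = b →
      ∃ c, IsLbColoring G L b c ∧ c v₀ = c₀

/-- The cycle `C n` on vertex set `ZMod n`. -/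
def cycleGraph (n : ℕ) : SimpleGraph (ZMod n) :=
  SimpleGraph.fromRel (fun i j => j = i + 1)

theorem aux_pick (S N : Finset ℤ) (b m : ℕ) (h1 : b ≤ S.card) (h2 : b ≤ (S \ N).card + m) :
    ∃ T ⊆ S, T.card = b ∧ (T ∩ N).card ≤ m := by
  by_cases h : b ≤ (S \ N).card
  · obtain ⟨T, hT, hc⟩ := Finset.exists_subset_card_eq h
    refine ⟨T, hT.trans Finset.sdiff_subset, hc, ?_⟩
    have : T ∩ N = ∅ := by
      ext x; simp only [Finset.mem_inter, Finset.notMem_empty, iff_false, not_and]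
      intro hx; exact (Finset.mem_sdiff.1 (hT hx)).2
    simp [this]
  · obtain ⟨T, hT1, hT2, hc⟩ := Finset.exists_subsuperset_card_eq
      (Finset.sdiff_subset (s := S) (t := N)) (by omega : (S \ N).card ≤ b) h1
    refine ⟨T, hT2, hc, ?_⟩
    have h3 : (S \ N) ⊆ T \ N := by
      intro x hx
      exact Finset.mem_sdiff.2 ⟨hT1 hx, (Finset.mem_sdiff.1 hx).2⟩
    have := Finset.card_le_card h3
    have := Finset.card_sdiff_add_card_inter T N
    omega

theorem aux_even (b e : ℕ) (L : ℕ → Finset ℤ) (hL : ∀ i, (L i).card = 2 * b + e)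
    (C : Finset ℤ) (hC : C.card = b) (j : ℕ) :
    ∃ M : Finset ℤ, M.card = b + e ∧ ∀ X : Finset ℤ, X.card = b → (X ∩ M).card ≤ (j + 1) * e →
      ∃ f : ℕ → Finset ℤ, f 0 = C ∧ f (2 * j + 2) = X ∧
        (∀ i, 0 < i → i < 2 * j + 2 → f i ⊆ L i ∧ (f i).card = b) ∧
        ∀ i, i < 2 * j + 2 → Disjoint (f i) (f (i + 1)) := by
  induction j with
  | zero =>
    have h1 : b + e ≤ (L 1 \ C).card := by
      have := Finset.le_card_sdiff C (L 1)
      have := hL 1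
      omega
    obtain ⟨M, hM, hMc⟩ := Finset.exists_subset_card_eq h1
    refine ⟨M, hMc, fun X hX hXM => ?_⟩
    have h2 : b ≤ (M \ X).card := by
      have := Finset.card_sdiff_add_card_inter M X
      rw [Finset.inter_comm] at this
      omega
    obtain ⟨Y, hY, hYc⟩ := Finset.exists_subset_card_eq h2
    have hYM := hY.trans Finset.sdiff_subset
    have hYL := hYM.trans hM
    refine ⟨fun i => if i = 0 then C else if i = 1 then Y else X, by simp, by simp, ?_, ?_⟩
    · intro i h0 h1
      have : i = 1 := by omega
      subst this
      simp only [one_ne_zero, if_false, if_true]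
      exact ⟨hYL.trans Finset.sdiff_subset, hYc⟩
    · intro i hi
      have : i = 0 ∨ i = 1 := by omega
      rcases this with rfl | rfl
      · simp only [if_true, zero_add, one_ne_zero, if_false]
        exact (Finset.disjoint_of_subset_left hYL Finset.sdiff_disjoint).symm
      · simp only [if_true, one_ne_zero, if_false]
        exact Finset.disjoint_of_subset_left hY Finset.sdiff_disjoint
  | succ j ih =>
    obtain ⟨M, hM, ih⟩ := ih
    have h1 : b ≤ (L (2 * j + 2) \ M).card := by
      have := Finset.le_card_sdiff M (L (2 * j + 2))
      have := hL (2 * j + 2)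
      omega
    obtain ⟨M2, hM2, hM2c⟩ := Finset.exists_subset_card_eq h1
    have h2 : b + e ≤ (L (2 * j + 3) \ M2).card := by
      have := Finset.le_card_sdiff M2 (L (2 * j + 3))
      have := hL (2 * j + 3)
      omega
    obtain ⟨M3, hM3, hM3c⟩ := Finset.exists_subset_card_eq h2
    refine ⟨M3, hM3c, fun Z hZ hZM => ?_⟩
    have e1 : (j + 1 + 1) * e = (j + 1) * e + e := by ring
    obtain ⟨Y, hY, hYc, hYM⟩ := aux_pick (L (2 * j + 3) \ Z) M2 b ((j + 1) * e)
      (by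
        have := Finset.le_card_sdiff Z (L (2 * j + 3))
        have := hL (2 * j + 3)
        omega)
      (by
        have h3 : M3 \ Z ⊆ (L (2 * j + 3) \ Z) \ M2 := by
          intro x hx
          have := Finset.mem_sdiff.1 hx
          have := Finset.mem_sdiff.1 (hM3 this.1)
          simp_all
        have := Finset.card_le_card h3
        have := Finset.card_sdiff_add_card_inter M3 Z
        rw [Finset.inter_comm] at this
        omega)
    obtain ⟨X, hX, hXc, hXM⟩ := aux_pick (L (2 * j + 2) \ Y) M b ((j + 1) * e)
      (by
        have := Finset.le_card_sdiff Y (L (2 * j + 2))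
        have := hL (2 * j + 2)
        omega)
      (by
        have h3 : M2 \ Y ⊆ (L (2 * j + 2) \ Y) \ M := by
          intro x hx
          have := Finset.mem_sdiff.1 hx
          have := Finset.mem_sdiff.1 (hM2 this.1)
          simp_all
        have := Finset.card_le_card h3
        have := Finset.card_sdiff_add_card_inter M2 Y
        rw [Finset.inter_comm] at this
        omega)
    obtain ⟨f, hf0, hf1, hf2, hf3⟩ := ih X hXc hXM
    refine ⟨fun i => if i ≤ 2 * j + 2 then f i else if i = 2 * j + 3 then Y else Z,
      by simp [hf0], ?_, ?_, ?_⟩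
    · simp only
      rw [if_neg (by omega), if_neg (by omega)]
    · intro i h0 h1
      simp only
      by_cases c1 : i < 2 * j + 2
      · rw [if_pos (by omega)]
        exact hf2 i h0 c1
      by_cases c2 : i = 2 * j + 2
      · subst c2
        rw [if_pos le_rfl, hf1]
        exact ⟨hX.trans Finset.sdiff_subset, hXc⟩
      · have : i = 2 * j + 3 := by omega
        subst this
        rw [if_neg (by omega), if_pos rfl]
        exact ⟨hY.trans Finset.sdiff_subset, hYc⟩
    · intro i h1
      simp only
      by_cases c1 : i < 2 * j + 2
      · rw [if_pos (by omega), if_pos (by omega)]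
        exact hf3 i c1
      by_cases c2 : i = 2 * j + 2
      · subst c2
        rw [if_pos le_rfl, if_neg (by omega), if_pos (by omega), hf1]
        exact Finset.disjoint_of_subset_left hX Finset.sdiff_disjoint
      · have : i = 2 * j + 3 := by omega
        subst this
        rw [if_neg (by omega), if_pos rfl, if_neg (by omega), if_neg (by omega)]
        exact Finset.disjoint_of_subset_left hY Finset.sdiff_disjoint

theorem aux_even' (b e : ℕ) (L : ℕ → Finset ℤ) (hL : ∀ i, (L i).card = 2 * b + e)
    (C D : Finset ℤ) (hC : C.card = b) (hD : D.card = b) (k : ℕ) (hk : 0 < k) (hke : b ≤ k * e) :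
      ∃ f : ℕ → Finset ℤ, f 0 = C ∧ f (2 * k) = D ∧
        (∀ i, 0 < i → i < 2 * k → f i ⊆ L i ∧ (f i).card = b) ∧
        ∀ i, i < 2 * k → Disjoint (f i) (f (i + 1)) := by
  obtain ⟨j, rfl⟩ : ∃ j, k = j + 1 := ⟨k - 1, by omega⟩
  obtain ⟨M, -, h⟩ := aux_even b e L hL C hC j
  exact h D hD ((Finset.card_le_card Finset.inter_subset_left).trans (by omega))

theorem aux_path (b e : ℕ) (L : ℕ → Finset ℤ) (hL : ∀ i, (L i).card = 2 * b + e)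
    (C D : Finset ℤ) (hC : C.card = b) (hD : D.card = b) (n : ℕ) (hn : 2 ≤ n)
    (hke : b ≤ (n / 2) * e) :
      ∃ f : ℕ → Finset ℤ, f 0 = C ∧ f n = D ∧
        (∀ i, 0 < i → i < n → f i ⊆ L i ∧ (f i).card = b) ∧
        ∀ i, i < n → Disjoint (f i) (f (i + 1)) := by
  rcases Nat.even_or_odd' n with ⟨k, rfl | rfl⟩
  · exact aux_even' b e L hL C D hC hD k (by omega) (by simpa using hke)
  · have h1 : b ≤ (L 1 \ C).card := by
      have := Finset.le_card_sdiff C (L 1)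
      have := hL 1
      omega
    obtain ⟨X, hX, hXc⟩ := Finset.exists_subset_card_eq h1
    have hk2 : (2 * k + 1) / 2 = k := by omega
    rw [hk2] at hke
    obtain ⟨f, h0, h1, h2, h3⟩ := aux_even' b e (fun i => L (i + 1)) (fun i => hL _) X D hXc hD k
      (by omega) hke
    refine ⟨fun i => if i = 0 then C else f (i - 1), by simp, ?_, ?_, ?_⟩
    · simp [h1]
    · intro i hi hi'
      simp only
      rw [if_neg (by omega)]
      obtain ⟨i, rfl⟩ : ∃ j, i = j + 1 := ⟨i - 1, by omega⟩
      rw [Nat.add_sub_cancel]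
      by_cases c : i = 0
      · subst c
        rw [h0]
        exact ⟨hX.trans Finset.sdiff_subset, hXc⟩
      · exact h2 i (by omega) (by omega)
    · intro i hi
      simp only
      by_cases c : i = 0
      · subst c
        simp only [if_true, zero_add, one_ne_zero, if_false]
        rw [Nat.sub_self, h0]
        exact (Finset.disjoint_of_subset_left hX Finset.sdiff_disjoint).symm
      · rw [if_neg c, if_neg (by omega)]
        have := h3 (i - 1) (by omega)
        rwa [Nat.sub_add_cancel (by omega)] at this

theorem aux_cycle_card {V : Type*} [DecidableEq V] {G : SimpleGraph V} {u : V} {p : G.Walk u u}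
    (hp : p.IsCycle) : p.support.toFinset.card = p.length := by
  have h1 : p.support.toFinset = p.support.tail.toFinset := by
    conv_lhs => rw [← SimpleGraph.Walk.cons_tail_support]
    rw [List.toFinset_cons, Finset.insert_eq_self, List.mem_toFinset]
    exact SimpleGraph.Walk.end_mem_tail_support hp.not_nil
  rw [h1, List.toFinset_card_of_nodup hp.support_nodup]
  simp

theorem aux_chord {V : Type*} [DecidableEq V] {G : SimpleGraph V}
    (hdisjcyc : ∀ (u v : V) (p : G.Walk u u) (q : G.Walk v v),
      p.IsCycle → q.IsCycle →
      p.support.toFinset = q.support.toFinset ∨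
        Disjoint p.support.toFinset q.support.toFinset)
    {u : V} {p : G.Walk u u} (hp : p.IsCycle) {x y : V} (hx : x ∈ p.support) (hy : y ∈ p.support)
    (hxy : G.Adj x y) : s(x, y) ∈ p.edges := by
  by_contra hne
  have hq : (p.rotate x hx).IsCycle := hp.rotate hx
  have hyq : y ∈ (p.rotate x hx).support := by
    rwa [SimpleGraph.Walk.mem_support_rotate_iff]
  have hneq : s(x, y) ∉ (p.rotate x hx).edges := by
    rwa [(p.rotate_edges x hx).mem_iff]
  generalize p.rotate x hx = q at *
  have hpath := hq.isPath_takeUntil hyq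
  have hsp := SimpleGraph.Walk.take_spec q hyq
  have hl := congrArg SimpleGraph.Walk.length hsp
  rw [SimpleGraph.Walk.length_append] at hl
  have hc : (SimpleGraph.Walk.cons hxy.symm (q.takeUntil y hyq)).IsCycle := by
    rw [SimpleGraph.Walk.cons_isCycle_iff]
    refine ⟨hpath, fun h => hneq ?_⟩
    rw [Sym2.eq_swap]
    exact SimpleGraph.Walk.edges_takeUntil_subset_edges _ _ h
  rcases hdisjcyc _ _ _ _ hq hc with h | h
  · have := congrArg Finset.card h
    rw [aux_cycle_card hq, aux_cycle_card hc, SimpleGraph.Walk.length_cons] at this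
    have h1 : (q.dropUntil y hyq).length = 1 := by omega
    apply hneq
    rw [← hsp, SimpleGraph.Walk.edges_append, List.mem_append]
    right
    generalize q.dropUntil y hyq = d at h1
    rw [SimpleGraph.Walk.mk_mem_edges_iff_exists]
    refine ⟨0, by omega, ?_⟩
    have e1 : d.getVert 1 = x := by rw [← h1]; exact d.getVert_length
    rw [SimpleGraph.Walk.getVert_zero, zero_add, e1, Sym2.eq_swap]
  · have h1 : x ∈ q.support := by simp
    have h2 : x ∈ (SimpleGraph.Walk.cons hxy.symm (q.takeUntil y hyq)).support := by simp
    exact Finset.disjoint_left.1 h (List.mem_toFinset.2 h1) (List.mem_toFinset.2 h2)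

theorem aux_cycle_color {V : Type*} [DecidableEq V] {G : SimpleGraph V}
    (b e : ℕ) (L : V → Finset ℤ) (hL : ∀ v, (L v).card = 2 * b + e)
    {u : V} {p : G.Walk u u} (hp : p.IsCycle) (hk : b ≤ (p.length / 2) * e)
    (C : Finset ℤ) (hC : C.card = b) (hCL : C ⊆ L u) :
    ∃ c : V → Finset ℤ, c u = C ∧ (∀ v ∈ p.support, c v ⊆ L v ∧ (c v).card = b) ∧
      ∀ x y, s(x, y) ∈ p.edges → Disjoint (c x) (c y) := by
  classical
  have h3 := hp.three_le_length
  obtain ⟨f, f0, fn, f1, f2⟩ := aux_path b e (fun i => L (p.getVert i)) (fun i => hL _) C C hC hC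
    p.length (by omega) hk
  have hex : ∀ v ∈ p.support, ∃ i, i < p.length ∧ p.getVert i = v := by
    intro v hv
    obtain ⟨i, hi, hi'⟩ := SimpleGraph.Walk.mem_support_iff_exists_getVert.1 hv
    by_cases c : i = p.length
    · exact ⟨0, by omega, by rw [← hi, c]; simp⟩
    · exact ⟨i, by omega, hi⟩
  let c : V → Finset ℤ := fun v => if h : ∃ i, i < p.length ∧ p.getVert i = v then f h.choose else ∅
  have hc' : ∀ i, i < p.length → c (p.getVert i) = f i := by
    intro i hi
    have h : ∃ j, j < p.length ∧ p.getVert j = p.getVert i := ⟨i, hi, rfl⟩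
    have : c (p.getVert i) = f h.choose := dif_pos h
    rw [this]
    congr 1
    exact hp.getVert_injOn' (by have := h.choose_spec.1; simp only [Set.mem_ofPred_eq]; omega)
      (by simp only [Set.mem_ofPred_eq]; omega) h.choose_spec.2
  have hc : ∀ i, i ≤ p.length → c (p.getVert i) = f i := by
    intro i hi
    by_cases h : i = p.length
    · subst h
      have := hc' 0 (by omega)
      rw [SimpleGraph.Walk.getVert_zero] at this
      rw [SimpleGraph.Walk.getVert_length, this, f0, fn]
    · exact hc' i (by omega)
  refine ⟨c, ?_, ?_, ?_⟩
  · have := hc 0 (by omega)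
    rwa [SimpleGraph.Walk.getVert_zero, f0] at this
  · intro v hv
    obtain ⟨i, hi, rfl⟩ := hex v hv
    rw [hc i hi.le]
    by_cases h : i = 0
    · subst h
      rw [f0, SimpleGraph.Walk.getVert_zero]
      exact ⟨hCL, hC⟩
    · exact f1 i (by omega) hi
  · intro x y hxy
    obtain ⟨i, hi, h⟩ := (SimpleGraph.Walk.mk_mem_edges_iff_exists _).1 hxy
    have hd := f2 i hi
    rw [← hc i hi.le, ← hc (i + 1) hi] at hd
    rcases Sym2.eq_iff.1 h with ⟨rfl, rfl⟩ | ⟨rfl, rfl⟩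
    · exact hd
    · exact hd.symm

theorem aux_main {V : Type*} [Fintype V] [DecidableEq V] (g b e : ℕ) (hke : b ≤ (g / 2) * e)
    (L : V → Finset ℤ) (hL : ∀ v, (L v).card = 2 * b + e) (G : SimpleGraph V) :
    (∀ (u v : V) (p : G.Walk u u) (q : G.Walk v v), p.IsCycle → q.IsCycle →
      p.support.toFinset = q.support.toFinset ∨
        Disjoint p.support.toFinset q.support.toFinset) →
    (∀ (u : V) (p : G.Walk u u), p.IsCycle → g ≤ p.length) →
    ∀ v₀ : V, ∀ c₀ : Finset ℤ, c₀ ⊆ L v₀ → c₀.card = b →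
      ∃ c, IsLbColoring G L b c ∧ c v₀ = c₀ := by
  classical
  induction G using WellFoundedLT.induction with
  | ind G ih =>
  intro hd hg v₀ c₀ hc₀ hcb
  have key : ∀ u v, G.Adj u v → ∀ v₀ : V, ∀ c₀ : Finset ℤ, c₀ ⊆ L v₀ → c₀.card = b →
      ∃ c, IsLbColoring (G.deleteEdges {s(u, v)}) L b c ∧ c v₀ = c₀ := by
    intro u v huv
    have hle : G.deleteEdges {s(u, v)} ≤ G := SimpleGraph.deleteEdges_le _
    apply ih
    · refine lt_of_le_of_ne hle fun h => ?_
      have : (G.deleteEdges {s(u, v)}).Adj u v := by rw [h]; exact huv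
      simp at this
    · intro x y p q hp hq
      have := hd x y (p.mapLe hle) (q.mapLe hle) (hp.mapLe hle) (hq.mapLe hle)
      simpa using this
    · intro x p hp
      have := hg x (p.mapLe hle) (hp.mapLe hle)
      simpa using this
  by_cases hbr : ∃ u v, G.Adj u v ∧ G.IsBridge s(u, v)
  · -- bridge case; we arrange that `v` is on the side away from `v₀`
    obtain ⟨u, v, huv, hb, hv⟩ : ∃ u v, G.Adj u v ∧ G.IsBridge s(u, v) ∧
        ¬ (G.deleteEdges {s(u, v)}).Reachable v v₀ := by
      obtain ⟨u, v, huv, hb⟩ := hbr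
      by_cases h : (G.deleteEdges {s(u, v)}).Reachable v v₀
      · refine ⟨v, u, huv.symm, by rwa [Sym2.eq_swap], fun h' => ?_⟩
        rw [Sym2.eq_swap] at h'
        exact (SimpleGraph.isBridge_iff.1 hb) (h'.trans h.symm)
      · exact ⟨u, v, huv, hb, h⟩
    obtain ⟨c, hc, hcv⟩ := key u v huv v₀ c₀ hc₀ hcb
    have h1 : b ≤ (L v \ c u).card := by
      have := Finset.le_card_sdiff (c u) (L v)
      have := hL v
      have := hc.2.1 u
      omega
    obtain ⟨X, hX, hXc⟩ := Finset.exists_subset_card_eq h1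
    obtain ⟨d, hd', hdv⟩ := key u v huv v X (hX.trans Finset.sdiff_subset) hXc
    have hu : ¬ (G.deleteEdges {s(u, v)}).Reachable v u := fun h =>
      (SimpleGraph.isBridge_iff.1 hb) h.symm
    have huvd : Disjoint (c u) (d v) := by
      rw [hdv]
      exact (Finset.disjoint_of_subset_left hX Finset.sdiff_disjoint).symm
    refine ⟨fun x => if (G.deleteEdges {s(u, v)}).Reachable v x then d x else c x,
      ⟨?_, ?_, ?_⟩, ?_⟩
    · intro x
      simp only
      split_ifs
      · exact hd'.1 x
      · exact hc.1 x
    · intro x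
      simp only
      split_ifs
      · exact hd'.2.1 x
      · exact hc.2.1 x
    · intro x y hxy
      simp only
      by_cases hE : s(x, y) = s(u, v)
      · rcases Sym2.eq_iff.1 hE with ⟨rfl, rfl⟩ | ⟨rfl, rfl⟩
        · rw [if_neg hu, if_pos (SimpleGraph.Reachable.refl _)]
          exact huvd
        · rw [if_neg hu, if_pos (SimpleGraph.Reachable.refl _)]
          exact huvd.symm
      · have hadj : (G.deleteEdges {s(u, v)}).Adj x y := by
          rw [SimpleGraph.deleteEdges_adj]
          exact ⟨hxy, hE⟩
        have hiff : (G.deleteEdges {s(u, v)}).Reachable v x ↔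
            (G.deleteEdges {s(u, v)}).Reachable v y :=
          ⟨fun h => h.trans hadj.reachable, fun h => h.trans hadj.symm.reachable⟩
        by_cases h : (G.deleteEdges {s(u, v)}).Reachable v x
        · rw [if_pos h, if_pos (hiff.1 h)]
          exact hd'.2.2 hadj
        · rw [if_neg h, if_neg (fun h' => h (hiff.2 h'))]
          exact hc.2.2 hadj
    · simp only
      rw [if_neg hv, hcv]
  have hcyc : ∀ u v, G.Adj u v → ∃ (w : V) (p : G.Walk w w), p.IsCycle ∧ s(u, v) ∈ p.edges := by
    intro u v huv
    by_contra hcon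
    push Not at hcon
    exact hbr ⟨u, v, huv, (SimpleGraph.isBridge_iff_forall_cycle_notMem huv).2 hcon⟩
  by_cases hE : ∃ u v, G.Adj u v
  · obtain ⟨u, v, huv⟩ := hE
    obtain ⟨w, p, hp, hup⟩ := hcyc u v huv
    obtain ⟨c, hc, hcv⟩ := key u v huv v₀ c₀ hc₀ hcb
    obtain ⟨w, p, hp, hup, hw⟩ : ∃ (w : V) (p : G.Walk w w), p.IsCycle ∧ s(u, v) ∈ p.edges ∧
        (v₀ ∈ p.support → w = v₀) := by
      by_cases h : v₀ ∈ p.support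
      · exact ⟨v₀, p.rotate v₀ h, hp.rotate h, (p.rotate_edges v₀ h).mem_iff.2 hup, fun _ => rfl⟩
      · exact ⟨w, p, hp, hup, fun h' => absurd h' h⟩
    obtain ⟨d, hdw, hd1, hd2⟩ := aux_cycle_color b e L hL hp
      (hke.trans (Nat.mul_le_mul_right _ (Nat.div_le_div_right (hg _ p hp)))) (c w) (hc.2.1 w)
      (hc.1 w)
    have hclosed : ∀ x y, G.Adj x y → x ∈ p.support → y ∈ p.support := by
      intro x y hxy hx
      obtain ⟨z, q, hq, hxq⟩ := hcyc x y hxy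
      have hx' := q.fst_mem_support_of_mem_edges hxq
      have hy' := q.snd_mem_support_of_mem_edges hxq
      rcases hd _ _ p q hp hq with h | h
      · rw [← List.mem_toFinset, h, List.mem_toFinset]
        exact hy'
      · exact absurd (List.mem_toFinset.2 hx') (Finset.disjoint_left.1 h (List.mem_toFinset.2 hx))
    refine ⟨fun x => if x ∈ p.support then d x else c x, ⟨?_, ?_, ?_⟩, ?_⟩
    · intro x
      simp only
      split_ifs with h
      · exact (hd1 x h).1
      · exact hc.1 x
    · intro x
      simp only
      split_ifs with h
      · exact (hd1 x h).2
      · exact hc.2.1 x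
    · intro x y hxy
      simp only
      by_cases h : x ∈ p.support
      · have hy := hclosed x y hxy h
        rw [if_pos h, if_pos hy]
        exact hd2 x y (aux_chord hd hp h hy hxy)
      · rw [if_neg h, if_neg (fun hy => h (hclosed y x hxy.symm hy))]
        apply hc.2.2
        rw [SimpleGraph.deleteEdges_adj]
        refine ⟨hxy, fun h' => h ?_⟩
        rw [Set.mem_singleton_iff] at h'
        rw [← h'] at hup
        exact p.fst_mem_support_of_mem_edges hup
    · simp only
      split_ifs with h
      · have := hw h
        subst this
        rw [hdw, hcv]
      · exact hcv
  · have hx : ∀ x, ∃ X ⊆ L x, X.card = b := fun x =>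
      Finset.exists_subset_card_eq (by rw [hL]; omega)
    choose c hc1 hc2 using hx
    refine ⟨fun x => if x = v₀ then c₀ else c x, ⟨?_, ?_, ?_⟩, by simp⟩
    · intro x
      simp only
      split_ifs with h
      · rw [h]; exact hc₀
      · exact hc1 x
    · intro x
      simp only
      split_ifs with h
      · exact hcb
      · exact hc2 x
    · intro x y hxy
      exact absurd ⟨x, y, hxy⟩ hE

/-- a tree of cycles (connected graph whose cycles are pairwise
vertex-disjoint) of girth `g` is free (a,b)-choosable whenever
`a/b ≥ 2 + 1/⌊g/2⌋`. -/
theorem stmt15 {V : Type*} [Fintype V] [DecidableEq V] (G : SimpleGraph V)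
    (hconn : G.Connected)
    (hdisjcyc : ∀ (u v : V) (p : G.Walk u u) (q : G.Walk v v),
      p.IsCycle → q.IsCycle →
      p.support.toFinset = q.support.toFinset ∨
        Disjoint p.support.toFinset q.support.toFinset)
    (g : ℕ) (hg3 : 3 ≤ g) (hg : G.girth = g)
    (a b : ℕ) (ha : 0 < a) (hb : 0 < b)
    (hab : (a : ℚ) / b ≥ 2 + 1 / ((g / 2 : ℕ) : ℚ)) :
    FreeChoosable G a b := by
  intro L hL v₀ c₀ hc₀ hcb
  have hk : 0 < g / 2 := by omega
  have hmul : (2 * (g / 2) + 1) * b ≤ a * (g / 2) := by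
    have hkq : (0 : ℚ) < ((g / 2 : ℕ) : ℚ) := by exact_mod_cast hk
    have hbq : (0 : ℚ) < (b : ℚ) := by exact_mod_cast hb
    have h2 : (2 + 1 / ((g / 2 : ℕ) : ℚ)) * b ≤ a := (le_div_iff₀ hbq).1 hab
    have h3 := mul_le_mul_of_nonneg_right h2 hkq.le
    have h4 : (2 + 1 / ((g / 2 : ℕ) : ℚ)) * b * ((g / 2 : ℕ) : ℚ)
        = (2 * ((g / 2 : ℕ) : ℚ) + 1) * b := by
      field_simp
    rw [h4] at h3
    exact_mod_cast h3
  generalize hkk : g / 2 = k at *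
  have h2b : 2 * b ≤ a := by
    by_contra hlt
    have : a * k ≤ (2 * b) * k := Nat.mul_le_mul_right _ (by omega)
    nlinarith
  obtain ⟨e, rfl⟩ := Nat.exists_eq_add_of_le h2b
  refine aux_main g b e (by rw [hkk]; nlinarith) L hL G hdisjcyc ?_ v₀ c₀ hc₀ hcb
  intro u p hp
  rw [← hg]
  exact SimpleGraph.girth_le_length hp
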